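/- Let μ be a (positive) measure on (0,∞) and let f : [0,∞) → ℝ be given by f(x) = ∫_(0,∞) (1 - exp(-x·t)) dμ(t), where this integral is finite for every x ≥ 0. Then for all a, b ≥ 0, f(a+b) - f(a) - f(b) ≥ f(2√(ab)) - 2·f(√(ab)). -/

import Mathlib

open MeasureTheory

lemma aux_exp {x y : ℝ} (hx : 0 < x) (h : x ≤ y) :
    y * (Real.exp x - 1) ≤ x * (Real.exp y - 1) := by
  have hy : 0 < y := hx.trans_le h
  have := convexOn_exp.2 (Set.mem_univ 0) (Set.mem_univ y)
    (show (0 : ℝ) ≤ 1 - x / y by rw [sub_nonneg, div_le_one hy]; exact h)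
    (show (0 : ℝ) ≤ x / y by positivity) (by ring)
  simp only [smul_eq_mul, mul_zero, zero_add, Real.exp_zero, mul_one] at this
  rw [div_mul_cancel₀ _ hy.ne'] at this
  have h2 := mul_le_mul_of_nonneg_left this hy.le
  have h3 : y * (1 - x / y + x / y * Real.exp y) = y - x + x * Real.exp y := by
    field_simp
  rw [h3] at h2
  linarith

lemma aux_pos {x : ℝ} (hx : 0 < x) : 0 < 1 - Real.exp (-x) := by
  have : Real.exp (-x) < 1 := by simpa using hx
  linarith

lemma aux_deriv (u : ℝ) : HasDerivAt (fun u => Real.log (1 - Real.exp (-Real.exp u)))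
    (Real.exp u / (Real.exp (Real.exp u) - 1)) u := by
  have hp := aux_pos (Real.exp_pos u)
  have h := ((((Real.hasDerivAt_exp u).neg).exp).const_sub 1).log hp.ne'
  refine h.congr_deriv ?_
  have h1 : 0 < Real.exp (Real.exp u) - 1 := by
    have := Real.one_lt_exp_iff.2 (Real.exp_pos u)
    linarith
  have h2 : Real.exp (Real.exp u) * Real.exp (-Real.exp u) = 1 := by
    rw [← Real.exp_add]; simp
  simp only [Pi.neg_apply]
  rw [div_eq_div_iff hp.ne' h1.ne']
  linear_combination (Real.exp u) * h2

lemma aux_concave : ConcaveOn ℝ Set.univ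
    (fun u => Real.log (1 - Real.exp (-Real.exp u))) := by
  apply Antitone.concaveOn_univ_of_deriv
  · exact fun u => (aux_deriv u).differentiableAt
  · intro u v huv
    rw [(aux_deriv u).deriv, (aux_deriv v).deriv]
    have h1 : ∀ u : ℝ, 0 < Real.exp (Real.exp u) - 1 := fun u => by
      have := Real.one_lt_exp_iff.2 (Real.exp_pos u)
      linarith
    rw [div_le_div_iff₀ (h1 v) (h1 u)]
    exact aux_exp (Real.exp_pos u) (Real.exp_le_exp.2 huv)

lemma aux_mul {p q r : ℝ} (hp : 0 < p) (hq : 0 < q) (hr : 0 < r) (h : r ^ 2 = p * q) :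
    (1 - Real.exp (-p)) * (1 - Real.exp (-q)) ≤ (1 - Real.exp (-r)) ^ 2 := by
  have hc := aux_concave.2 (Set.mem_univ (Real.log p)) (Set.mem_univ (Real.log q))
    (show (0 : ℝ) ≤ 1 / 2 by norm_num) (show (0 : ℝ) ≤ 1 / 2 by norm_num) (by norm_num)
  have hl : (1 / 2 : ℝ) • Real.log p + (1 / 2 : ℝ) • Real.log q = Real.log r := by
    have := congrArg Real.log h
    rw [Real.log_pow, Real.log_mul hp.ne' hq.ne'] at this
    simp only [smul_eq_mul]
    push_cast at this
    linarith
  rw [hl] at hc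
  simp only [Real.exp_log hp, Real.exp_log hq, Real.exp_log hr, smul_eq_mul] at hc
  have h1 := aux_pos hp
  have h2 := aux_pos hq
  have h3 := aux_pos hr
  rw [← Real.log_le_log_iff (by positivity) (by positivity), Real.log_mul h1.ne' h2.ne',
    Real.log_pow]
  push_cast
  linarith

/-- If `f` is a bare Bernstein function (class `BF0`), i.e.
`f x = ∫_(0,∞) (1 - exp(-x·t)) dμ(t)` for a positive measure `μ` on `(0,∞)`
(the integral being finite for every `x ≥ 0`), then for all `a, b ≥ 0`,
`f(a+b) - f(a) - f(b) ≥ f(2√(ab)) - 2·f(√(ab))`. -/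
theorem bf0_kernel_inequality (μ : Measure ℝ) (f : ℝ → ℝ)
    (hint : ∀ x ≥ 0, IntegrableOn (fun t => 1 - Real.exp (-(x * t))) (Set.Ioi 0) μ)
    (hf : ∀ x ≥ 0, f x = ∫ t in Set.Ioi (0 : ℝ), (1 - Real.exp (-(x * t))) ∂μ)
    (a b : ℝ) (ha : 0 ≤ a) (hb : 0 ≤ b) :
    f (a + b) - f a - f b ≥ f (2 * Real.sqrt (a * b)) - 2 * f (Real.sqrt (a * b)) := by
  have h0 : f 0 = 0 := by rw [hf 0 le_rfl]; simp
  rcases ha.eq_or_lt with rfl | ha'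
  · simp [h0]
  rcases hb.eq_or_lt with rfl | hb'
  · simp [h0]
  have hc : 0 < Real.sqrt (a * b) := Real.sqrt_pos.2 (by positivity)
  have hc2 : Real.sqrt (a * b) ^ 2 = a * b := Real.sq_sqrt (by positivity)
  generalize Real.sqrt (a * b) = c at hc hc2
  have i1 := hint (a + b) (by positivity)
  have i2 := hint a ha
  have i3 := hint b hb
  have i4 := hint (2 * c) (by positivity)
  have i5 := hint c hc.le
  rw [hf (a + b) (by positivity), hf a ha, hf b hb, hf (2 * c) (by positivity), hf c hc.le,
    ← integral_const_mul, ← integral_sub i1 i2, ← integral_sub (by exact i1.sub i2) i3,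
    ← integral_sub i4 (i5.const_mul 2)]
  refine setIntegral_mono_on (i4.sub (i5.const_mul 2)) ((i1.sub i2).sub i3) measurableSet_Ioi ?_
  intro t ht
  have ht' : 0 < t := ht
  have key := aux_mul (mul_pos ha' ht') (mul_pos hb' ht') (mul_pos hc ht')
    (by linear_combination t ^ 2 * hc2)
  have e1 : Real.exp (-((a + b) * t)) = Real.exp (-(a * t)) * Real.exp (-(b * t)) := by
    rw [← Real.exp_add]; ring_nf
  have e2 : Real.exp (-(2 * c * t)) = Real.exp (-(c * t)) * Real.exp (-(c * t)) := by
    rw [← Real.exp_add]; ring_nf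
  simp only [e1, e2]
  nlinarith [key]
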